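/- Fix integers 2 ≤ c ≤ d, s ≥ c and 0 ≤ p ≤ c, and reals Q₁ > 0, Q₂ > 0 and ν < 0. Then there exist reals R > 0 and S > 0 such that for all a > 0: |B(c,Q₁,a,p,s)/B(c,Q₂,a,0,s) − C(s−p, s−c+1)/C(s, s−c+1)| < R·e^{−S·a}, where C(n,k) denotes the binomial coefficient (equal to 0 when k > n); here B(c,Q₂,a,0,s) > 0 so the quotient is well defined. -/

import Mathlib

/-- `A(c,q,s,n) = Σ_F ∏_{j∈F} n_j` over subsets `F ⊆ {1,…,s}` with
`c−q ≤ |F| ≤ c` and `|F ∪ {1,…,q}| ≥ c`. -/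
def Afun (c q s : ℕ) (n : Fin s → ℕ) : ℕ :=
  ∑ F ∈ Finset.univ.powerset.filter
      (fun F : Finset (Fin s) => c - q ≤ F.card ∧ F.card ≤ c ∧
        c ≤ (F ∪ Finset.univ.filter fun j : Fin s => (j : ℕ) < q).card),
    ∏ j ∈ F, n j

/-- `B(c,Q,a,q,s)`, cf. (bck). -/
noncomputable def Bfun (d c : ℕ) (ν Q a : ℝ) (q s : ℕ) : ℝ :=
  ∑' n : Fin s → ℕ,
    (a ^ (∑ i, n i) / ∏ i, (Nat.factorial (n i) : ℝ))
      * Real.exp (ν * Q ^ (d - c) * (Afun c q s n : ℝ) - a * (c - 1))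

open Finset in
lemma hasSum_pi_prod : ∀ (s : ℕ) (f : Fin s → ℕ → ℝ) (x : Fin s → ℝ),
    (∀ i k, 0 ≤ f i k) → (∀ i, HasSum (f i) (x i)) →
    HasSum (fun n : Fin s → ℕ => ∏ i, f i (n i)) (∏ i, x i) := by
  intro s
  induction s with
  | zero =>
    intro f x _ _
    simp only [Finset.univ_eq_empty, Finset.prod_empty]
    exact hasSum_unique (fun n : Fin 0 → ℕ => (1:ℝ))
  | succ s ih =>
    intro f x hf hx
    have h1 := ih (fun i => f i.succ) (fun i => x i.succ) (fun i k => hf _ _) (fun i => hx _)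
    have h0 := hx 0
    have hs : Summable (fun p : ℕ × (Fin s → ℕ) => f 0 p.1 * ∏ i, f (Fin.succ i) (p.2 i)) :=
      Summable.mul_of_nonneg (f := f 0) (g := fun n : Fin s → ℕ => ∏ i, f (Fin.succ i) (n i))
        h0.summable h1.summable (fun k => hf 0 k)
        (fun n => Finset.prod_nonneg fun i _ => hf (Fin.succ i) (n i))
    have h2 := h0.mul h1 hs
    rw [Fin.prod_univ_succ]
    rw [← (Fin.consEquiv (fun _ : Fin (s+1) => ℕ)).hasSum_iff]
    have e : ((fun n : Fin (s+1) → ℕ => ∏ i, f i (n i)) ∘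
        (Fin.consEquiv (fun _ : Fin (s+1) => ℕ))) =
        fun p : ℕ × (Fin s → ℕ) => f 0 p.1 * ∏ i, f (Fin.succ i) (p.2 i) := by
      funext p
      simp [Fin.prod_univ_succ, Fin.consEquiv]
    rw [e]
    exact h2

def supp7 {s : ℕ} (n : Fin s → ℕ) : Finset (Fin s) := Finset.univ.filter fun j => n j ≠ 0

def init7 (s q : ℕ) : Finset (Fin s) := Finset.univ.filter fun j : Fin s => (j : ℕ) < q

lemma Afun_eq_zero (c q s : ℕ) (n : Fin s → ℕ) (h : (supp7 n ∪ init7 s q).card < c) :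
    Afun c q s n = 0 := by
  unfold Afun
  refine Finset.sum_eq_zero fun F hF => ?_
  simp only [Finset.mem_filter] at hF
  by_contra hne
  have hsub : F ⊆ supp7 n := by
    intro j hj
    simp only [supp7, Finset.mem_filter, Finset.mem_univ, true_and]
    exact Finset.prod_ne_zero_iff.mp hne j hj
  have : (F ∪ init7 s q).card ≤ (supp7 n ∪ init7 s q).card :=
    Finset.card_le_card (Finset.union_subset_union_left hsub)
  have h3 := hF.2.2.2
  unfold init7 at *
  omega

lemma le_Afun (c q s : ℕ) (n : Fin s → ℕ) (F G : Finset (Fin s)) (hGF : G ⊆ F)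
    (h1 : c - q ≤ F.card) (h2 : F.card ≤ c) (h3 : c ≤ (F ∪ init7 s q).card)
    (hpos : ∀ j ∈ F, n j ≠ 0) : ∏ j ∈ G, n j ≤ Afun c q s n := by
  have h4 : ∏ j ∈ G, n j ≤ ∏ j ∈ F, n j :=
    Nat.le_of_dvd (Nat.pos_of_ne_zero (Finset.prod_ne_zero_iff.mpr hpos))
      (Finset.prod_dvd_prod_of_subset _ _ _ hGF)
  refine h4.trans ?_
  unfold Afun
  refine Finset.single_le_sum (f := fun F => ∏ j ∈ F, n j) (fun _ _ => Nat.zero_le _) ?_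
  simp only [Finset.mem_filter, Finset.mem_powerset]
  exact ⟨Finset.subset_univ _, h1, h2, h3⟩

lemma card_top (s m : ℕ) : (Finset.univ.filter fun i : Fin s => m ≤ (i : ℕ)).card = s - m := by
  have h := Finset.card_filter_add_card_filter_not (s := (Finset.univ : Finset (Fin s)))
    (fun i : Fin s => (i:ℕ) < m)
  simp only [not_lt, Finset.card_univ, Fintype.card_fin, Fin.card_filter_val_lt] at h
  omega

lemma Afun_ge_one (c q s : ℕ) (hc2 : 2 ≤ c) (hsc : c ≤ s) (n : Fin s → ℕ)
    (σ : Equiv.Perm (Fin s)) (hσ : Monotone (n ∘ σ)) (l : Fin s) (hl : (l : ℕ) = s - c + 1)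
    (hP : c ≤ (supp7 n ∪ init7 s q).card) : n (σ l) ≤ Afun c q s n := by
  by_cases h0 : n (σ l) = 0
  · omega
  set L : Finset (Fin s) := (Finset.univ.filter fun i : Fin s => s - c + 1 ≤ (i : ℕ)).map
    σ.toEmbedding with hL
  have hcard : L.card = c - 1 := by
    rw [hL, Finset.card_map, card_top]; omega
  have hpos : ∀ j ∈ L, n j ≠ 0 := by
    intro j hj
    simp only [hL, Finset.mem_map, Finset.mem_filter, Finset.mem_univ, true_and] at hj
    obtain ⟨i, hi, rfl⟩ := hj
    have : n (σ l) ≤ n (σ i) := hσ (show l ≤ i by rw [Fin.le_def]; omega)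
    simp only [Equiv.coe_toEmbedding]
    omega
  have hlL : σ l ∈ L := by
    simp only [hL, Finset.mem_map, Finset.mem_filter, Finset.mem_univ, true_and]
    exact ⟨l, hl.ge, rfl⟩
  have key : ∀ F : Finset (Fin s), L ⊆ F → c - q ≤ F.card → F.card ≤ c →
      c ≤ (F ∪ init7 s q).card → (∀ j ∈ F, n j ≠ 0) → n (σ l) ≤ Afun c q s n := by
    intro F hF h1 h2 h3 h4
    have := le_Afun c q s n F {σ l} (by simpa using hF hlL) h1 h2 h3 h4
    simpa using this
  by_cases hLq : c ≤ (L ∪ init7 s q).card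
  · refine key L (Finset.Subset.refl _) ?_ (by omega) hLq hpos
    rcases Nat.eq_zero_or_pos q with rfl | hq
    · simp [init7] at hLq
      omega
    · omega
  · have : ∃ j ∈ supp7 n ∪ init7 s q, j ∉ L ∪ init7 s q :=
      Finset.exists_mem_notMem_of_card_lt_card (by omega)
    obtain ⟨j, hj, hj'⟩ := this
    simp only [Finset.mem_union, not_or] at hj hj'
    have hjs : n j ≠ 0 := by
      rcases hj with hj | hj
      · simpa [supp7] using hj
      · exact absurd hj hj'.2
    have hc' : (insert j L).card = c := by
      rw [Finset.card_insert_of_notMem hj'.1]; omega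
    refine key (insert j L) (Finset.subset_insert _ _) (by omega) (by omega) ?_ ?_
    · have := Finset.card_le_card (Finset.subset_union_left (s₁ := insert j L) (s₂ := init7 s q))
      omega
    · intro i hi
      rcases Finset.mem_insert.mp hi with rfl | hi
      · exact hjs
      · exact hpos i hi

lemma Afun_ge_two (c q s : ℕ) (hc2 : 2 ≤ c) (hsc : c ≤ s) (n : Fin s → ℕ)
    (σ : Equiv.Perm (Fin s)) (hσ : Monotone (n ∘ σ)) (l k : Fin s) (hl : (l : ℕ) = s - c + 1)
    (hk : (k : ℕ) = s - c) : n (σ l) * n (σ k) ≤ Afun c q s n := by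
  by_cases h0 : n (σ k) = 0
  · simp [h0]
  set L : Finset (Fin s) := (Finset.univ.filter fun i : Fin s => s - c ≤ (i : ℕ)).map
    σ.toEmbedding with hL
  have hcard : L.card = c := by
    rw [hL, Finset.card_map, card_top]; omega
  have hpos : ∀ j ∈ L, n j ≠ 0 := by
    intro j hj
    simp only [hL, Finset.mem_map, Finset.mem_filter, Finset.mem_univ, true_and] at hj
    obtain ⟨i, hi, rfl⟩ := hj
    have : n (σ k) ≤ n (σ i) := hσ (show k ≤ i by rw [Fin.le_def]; omega)
    simp only [Equiv.coe_toEmbedding]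
    omega
  have hmem : ∀ i : Fin s, s - c ≤ (i : ℕ) → σ i ∈ L := by
    intro i hi
    simp only [hL, Finset.mem_map, Finset.mem_filter, Finset.mem_univ, true_and]
    exact ⟨i, hi, rfl⟩
  have hne : σ l ≠ σ k := by
    intro h
    have := σ.injective h
    rw [this] at hl
    omega
  have h3 : c ≤ (L ∪ init7 s q).card := by
    have := Finset.card_le_card (Finset.subset_union_left (s₁ := L) (s₂ := init7 s q))
    omega
  have := le_Afun c q s n L {σ l, σ k} (by
    intro j hj
    simp only [Finset.mem_insert, Finset.mem_singleton] at hj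
    rcases hj with rfl | rfl
    · exact hmem _ (by omega)
    · exact hmem _ (by omega)) (by omega) (by omega) h3 hpos
  rwa [Finset.prod_pair hne] at this

/-- exponents of the weights -/
noncomputable def tw (c s : ℕ) (κ D : ℝ) (i : Fin s) : ℝ :=
  if (i : ℕ) ≤ s - c then D else if (i : ℕ) = s - c + 1 then κ / 2 else 0

lemma pointwise7 (c q s : ℕ) (hc2 : 2 ≤ c) (hsc : c ≤ s) (κ D : ℝ) (hκ : 0 < κ) (hD : 0 < D)
    (n : Fin s → ℕ) (hP : c ≤ (supp7 n ∪ init7 s q).card) :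
    ∃ σ : Equiv.Perm (Fin s), Real.exp (-κ * (Afun c q s n : ℝ)) ≤
      Real.exp (s * D * (2 * s * D / κ)) * ∏ j, Real.exp (-tw c s κ D (σ.symm j)) ^ (n j) := by
  refine ⟨Tuple.sort n, ?_⟩
  set σ := Tuple.sort n with hσd
  have hσ : Monotone (n ∘ σ) := Tuple.monotone_sort n
  let l : Fin s := ⟨s - c + 1, by omega⟩
  let k : Fin s := ⟨s - c, by omega⟩
  have hA1 := Afun_ge_one c q s hc2 hsc n σ hσ l rfl hP
  have hA2 := Afun_ge_two c q s hc2 hsc n σ hσ l k rfl rfl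
  have hkl : n (σ k) ≤ n (σ l) := hσ (show k ≤ l by rw [Fin.le_def]; simp [k, l])
  have e1 : ∏ j, Real.exp (-tw c s κ D (σ.symm j)) ^ (n j)
      = Real.exp (-∑ i, tw c s κ D i * n (σ i)) := by
    rw [← Equiv.prod_comp σ, ← Finset.sum_neg_distrib, Real.exp_sum]
    refine Finset.prod_congr rfl fun i _ => ?_
    rw [← Real.exp_nat_mul]
    simp
    ring
  rw [e1, ← Real.exp_add, Real.exp_le_exp]
  have e2 : ∑ i, tw c s κ D i * n (σ i) ≤ s * D * n (σ k) + κ / 2 * n (σ l) := by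
    have : ∀ i ∈ (Finset.univ : Finset (Fin s)), tw c s κ D i * n (σ i) ≤
        D * n (σ k) + if i = l then κ / 2 * n (σ l) else 0 := by
      intro i _
      unfold tw
      by_cases h1 : (i : ℕ) ≤ s - c
      · have hil : i ≠ l := by
          intro h; rw [h] at h1; simp [l] at h1
        have : n (σ i) ≤ n (σ k) := hσ (show i ≤ k by rw [Fin.le_def]; exact h1)
        have : (n (σ i) : ℝ) ≤ n (σ k) := by exact_mod_cast this
        simp only [h1, hil, if_true, if_false, add_zero]
        gcongr
      · by_cases h2 : (i : ℕ) = s - c + 1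
        · have hil : i = l := Fin.ext h2
          simp only [h1, h2, hil, if_true, if_false]
          have : 0 ≤ D * n (σ k) := by positivity
          simp [l]
          linarith
        · have hil : i ≠ l := fun h => h2 (by rw [h])
          simp only [h1, h2, hil, if_false]
          simp
          positivity
    refine (Finset.sum_le_sum this).trans ?_
    rw [Finset.sum_add_distrib]
    simp
    linarith
  have hA1' : (n (σ l) : ℝ) ≤ Afun c q s n := by exact_mod_cast hA1
  have hA2' : (n (σ l) : ℝ) * n (σ k) ≤ Afun c q s n := by exact_mod_cast hA2
  have hkl' : (n (σ k) : ℝ) ≤ n (σ l) := by exact_mod_cast hkl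
  set x : ℝ := ((n (σ k) : ℕ) : ℝ) with hx
  set y : ℝ := ((n (σ l) : ℕ) : ℝ) with hy
  set A : ℝ := ((Afun c q s n : ℕ) : ℝ) with hA
  have hx0 : 0 ≤ x := by positivity
  set M : ℝ := 2 * s * D / κ with hM
  have hM' : s * D = κ / 2 * M := by rw [hM]; field_simp
  have hM0 : 0 ≤ M := by rw [hM]; positivity
  have hsD : 0 ≤ s * D := by positivity
  by_cases hxM : x ≤ M
  · have : s * D * x ≤ s * D * M := by gcongr
    have : κ * y ≤ κ * A := by gcongr
    have : 0 ≤ κ * y := mul_nonneg hκ.le (hx0.trans hkl')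
    linarith
  · push Not at hxM
    have hx1 : 1 ≤ x := by
      have : (0:ℝ) < n (σ k) := lt_of_le_of_lt hM0 hxM
      have : 1 ≤ n (σ k) := by exact_mod_cast this
      rw [hx]; exact_mod_cast this
    have h5 : κ * (y * x) ≤ κ * A := by gcongr
    have h6 : κ / 2 * y ≤ κ / 2 * (y * x) := by
      gcongr
      nlinarith
    have h7 : s * D * x ≤ κ / 2 * (y * x) := by
      rw [hM']
      have : M * x ≤ y * x := by gcongr; linarith
      nlinarith
    have : 0 ≤ s * D * M := by positivity
    linarith

lemma sum_tw (c s : ℕ) (hc2 : 2 ≤ c) (hsc : c ≤ s) (κ D : ℝ) :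
    ∑ i : Fin s, Real.exp (-tw c s κ D i) ≤
      s * Real.exp (-D) + Real.exp (-(κ / 2)) + (c - 2) := by
  let l : Fin s := ⟨s - c + 1, by omega⟩
  have : ∀ i ∈ (Finset.univ : Finset (Fin s)), Real.exp (-tw c s κ D i) ≤
      Real.exp (-D) + (if i = l then Real.exp (-(κ / 2)) else 0) +
        (if s - c + 2 ≤ (i : ℕ) then 1 else 0) := by
    intro i _
    unfold tw
    have hp1 := (Real.exp_pos (-D)).le
    have hp2 := (Real.exp_pos (-(κ/2))).le
    by_cases h1 : (i : ℕ) ≤ s - c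
    · simp only [h1, if_true]
      have : (0:ℝ) ≤ if i = l then Real.exp (-(κ / 2)) else 0 := by split_ifs <;> simp [hp2]
      have : (0:ℝ) ≤ if s - c + 2 ≤ (i : ℕ) then 1 else 0 := by split_ifs <;> simp
      linarith
    · by_cases h2 : (i : ℕ) = s - c + 1
      · have hil : i = l := Fin.ext h2
        have h3 : ¬ (s - c + 2 ≤ (i : ℕ)) := by omega
        rw [if_neg h1, if_pos h2, if_pos hil, if_neg h3]
        linarith
      · have hil : i ≠ l := fun h => h2 (by rw [h])
        have h3 : (s - c + 2 ≤ (i : ℕ)) := by omega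
        rw [if_neg h1, if_neg h2, if_neg hil, if_pos h3]
        simp [hp1]
  refine (Finset.sum_le_sum this).trans ?_
  rw [Finset.sum_add_distrib, Finset.sum_add_distrib, Finset.sum_boole, card_top]
  have : s - (s - c + 2) = c - 2 := by omega
  rw [this, Nat.cast_sub hc2]
  simp

lemma hasSum_weights (s : ℕ) (a : ℝ) (ha : 0 < a) (w : Fin s → ℝ) (hw : ∀ i, 0 ≤ w i) :
    HasSum (fun n : Fin s → ℕ => (a ^ (∑ i, n i) / ∏ i, (Nat.factorial (n i) : ℝ))
      * ∏ j, w j ^ n j) (Real.exp (a * ∑ j, w j)) := by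
  have h := hasSum_pi_prod s (fun i k => (a * w i) ^ k / (Nat.factorial k : ℝ))
    (fun i => Real.exp (a * w i)) (fun i k => by have := hw i; positivity)
    (fun i => by rw [Real.exp_eq_exp_ℝ]; exact NormedSpace.expSeries_div_hasSum_exp (a * w i))
  rw [← Real.exp_sum, ← Finset.mul_sum] at h
  convert h using 1
  funext n
  rw [Finset.prod_div_distrib, ← Finset.prod_pow_eq_pow_sum]
  simp only [mul_pow, Finset.prod_mul_distrib]
  ring

lemma hasSum_supp (s : ℕ) (a : ℝ) (ha : 0 < a) (T : Finset (Fin s)) :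
    HasSum (fun n : Fin s → ℕ => if supp7 n = T then
      (a ^ (∑ i, n i) / ∏ i, (Nat.factorial (n i) : ℝ)) else 0)
      ((Real.exp a - 1) ^ T.card) := by
  have hb : HasSum (fun k : ℕ => if k = 0 then (0:ℝ) else a ^ k / (Nat.factorial k : ℝ))
      (Real.exp a - 1) := by
    have h1 : HasSum (fun k : ℕ => a ^ k / (Nat.factorial k : ℝ)) (Real.exp a) := by
      rw [Real.exp_eq_exp_ℝ]; exact NormedSpace.expSeries_div_hasSum_exp a
    have h2 := h1.sub (hasSum_ite_eq (0:ℕ) (1:ℝ))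
    suffices e : (fun k : ℕ => if k = 0 then (0:ℝ) else a ^ k / (Nat.factorial k : ℝ)) =
        fun k => a ^ k / (Nat.factorial k : ℝ) - if k = 0 then 1 else 0 by
      rw [e]; exact h2
    funext k
    by_cases hk : k = 0
    · simp [hk]
    · simp [hk]
  have h := hasSum_pi_prod s (fun i k => if i ∈ T then
      (if k = 0 then (0:ℝ) else a ^ k / (Nat.factorial k : ℝ)) else if k = 0 then 1 else 0)
    (fun i => if i ∈ T then Real.exp a - 1 else 1)
    (fun i k => by split_ifs <;> positivity)
    (fun i => by
      by_cases hi : i ∈ T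
      · simpa [hi] using hb
      · simpa [hi] using hasSum_ite_eq (0:ℕ) (1:ℝ))
  have e : (∏ i : Fin s, if i ∈ T then Real.exp a - 1 else 1) = (Real.exp a - 1) ^ T.card := by
    rw [Finset.prod_ite_mem]; simp
  rw [e] at h
  convert h using 1
  funext n
  by_cases hT : supp7 n = T
  · rw [if_pos hT, ← Finset.prod_pow_eq_pow_sum, ← Finset.prod_div_distrib]
    refine Finset.prod_congr rfl fun i _ => ?_
    have : i ∈ T ↔ n i ≠ 0 := by rw [← hT]; simp [supp7]
    by_cases hi : n i = 0
    · simp [this, hi]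
    · simp [this, hi]
  · rw [if_neg hT]
    have : ∃ i, ¬ (i ∈ supp7 n ↔ i ∈ T) := by
      by_contra hcon
      push Not at hcon
      exact hT (Finset.ext hcon)
    obtain ⟨i, hi⟩ := this
    refine (Finset.prod_eq_zero (Finset.mem_univ i) ?_).symm
    simp only [supp7, Finset.mem_filter, Finset.mem_univ, true_and] at hi
    by_cases h1 : i ∈ T
    · have : n i = 0 := by tauto
      simp [h1, this]
    · have : n i ≠ 0 := by tauto
      simp [h1, this]

/-- the index sets of the main part -/
def fam7 (c q s : ℕ) : Finset (Finset (Fin s)) :=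
  Finset.univ.filter fun T => (T ∪ init7 s q).card < c

noncomputable def Zfun (c q s : ℕ) (a : ℝ) : ℝ :=
  (∑ T ∈ fam7 c q s, (Real.exp a - 1) ^ T.card) * Real.exp (-a * (c - 1))

lemma B_split (d c q s : ℕ) (hc2 : 2 ≤ c) (hsc : c ≤ s) (Q ν : ℝ) (hQ : 0 < Q) (hν : ν < 0) :
    ∃ R > (0:ℝ), ∃ S > (0:ℝ), ∀ a > (0:ℝ), ∃ H, 0 ≤ H ∧ H ≤ R * Real.exp (-S * a) ∧
      Bfun d c ν Q a q s = Zfun c q s a + H := by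
  set κ : ℝ := -(ν * Q ^ (d - c)) with hκd
  have hκ : 0 < κ := by
    have : 0 < Q ^ (d - c) := by positivity
    rw [hκd]; nlinarith
  have hs0 : (0:ℝ) < s := by
    have : 0 < s := by omega
    exact_mod_cast this
  set S : ℝ := (1 - Real.exp (-(κ / 2))) / 2 with hS
  have hexp1 : Real.exp (-(κ / 2)) < 1 := by rw [Real.exp_lt_one_iff]; linarith
  have hS0 : 0 < S := by rw [hS]; linarith
  have hS1 : S < 1 := by have := Real.exp_pos (-(κ/2)); rw [hS]; linarith
  set D : ℝ := -Real.log (S / s) with hDd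
  have hs1 : (1:ℝ) ≤ s := by
    have : 1 ≤ s := by omega
    exact_mod_cast this
  have hD : 0 < D := by
    rw [hDd]
    have : Real.log (S / s) < 0 := Real.log_neg (by positivity) (by
      rw [div_lt_one hs0]; linarith)
    linarith
  have hexpD : Real.exp (-D) = S / s := by
    rw [hDd, neg_neg, Real.exp_log (by positivity)]
  have hsum : ∑ i : Fin s, Real.exp (-tw c s κ D i) ≤ (c - 1) - S := by
    refine (sum_tw c s hc2 hsc κ D).trans ?_
    rw [hexpD, mul_div_cancel₀ _ hs0.ne']
    rw [hS]; linarith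
  set C : ℝ := Real.exp (s * D * (2 * s * D / κ)) with hC
  refine ⟨C * (Fintype.card (Equiv.Perm (Fin s)) : ℝ), by
    have : 0 < Fintype.card (Equiv.Perm (Fin s)) := Fintype.card_pos
    positivity, S, hS0, ?_⟩
  intro a ha
  set E : ℝ := Real.exp (-a * (c - 1)) with hE
  have hE0 : 0 < E := Real.exp_pos _
  let u : (Fin s → ℕ) → ℝ := fun n => a ^ (∑ i, n i) / ∏ i, (Nat.factorial (n i) : ℝ)
  have hu : ∀ n, 0 ≤ u n := fun n => by positivity
  -- main part
  have hg : HasSum (fun n : Fin s → ℕ => if (supp7 n ∪ init7 s q).card < c then u n * E else 0)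
      (Zfun c q s a) := by
    have h1 : HasSum (fun n : Fin s → ℕ => (∑ T ∈ fam7 c q s, if supp7 n = T then u n else 0) * E)
        (Zfun c q s a) :=
      (hasSum_sum (fun T _ => hasSum_supp s a ha T)).mul_right E
    convert h1 using 1
    funext n
    rw [Finset.sum_ite_eq]
    simp only [fam7, Finset.mem_filter, Finset.mem_univ, true_and]
    split_ifs <;> simp
  -- error part
  let h : (Fin s → ℕ) → ℝ := fun n => if (supp7 n ∪ init7 s q).card < c then 0 else
    u n * Real.exp (-κ * (Afun c q s n : ℝ)) * E
  let b : (Fin s → ℕ) → ℝ := fun n => C * E * ∑ σ : Equiv.Perm (Fin s),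
    u n * ∏ j, Real.exp (-tw c s κ D (σ.symm j)) ^ (n j)
  have hh0 : ∀ n, 0 ≤ h n := by
    intro n
    have := hu n
    simp only [h]
    split_ifs
    · exact le_rfl
    · positivity
  have hhb : ∀ n, h n ≤ b n := by
    intro n
    have hun := hu n
    simp only [h, b]
    split_ifs with hP
    · positivity
    · obtain ⟨σ, hσ⟩ := pointwise7 c q s hc2 hsc κ D hκ hD n (not_lt.mp hP)
      have h1 : u n * ∏ j, Real.exp (-tw c s κ D (σ.symm j)) ^ (n j) ≤
          ∑ σ : Equiv.Perm (Fin s), u n * ∏ j, Real.exp (-tw c s κ D (σ.symm j)) ^ (n j) :=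
        Finset.single_le_sum (f := fun σ : Equiv.Perm (Fin s) =>
          u n * ∏ j, Real.exp (-tw c s κ D (σ.symm j)) ^ (n j))
          (fun _ _ => by positivity) (Finset.mem_univ σ)
      calc u n * Real.exp (-κ * (Afun c q s n : ℝ)) * E
          ≤ u n * (C * ∏ j, Real.exp (-tw c s κ D (σ.symm j)) ^ (n j)) * E := by gcongr
        _ = C * E * (u n * ∏ j, Real.exp (-tw c s κ D (σ.symm j)) ^ (n j)) := by ring
        _ ≤ _ := by gcongr
  have hbs : HasSum b (C * E * ∑ σ : Equiv.Perm (Fin s),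
      Real.exp (a * ∑ j, Real.exp (-tw c s κ D (σ.symm j)))) :=
    (hasSum_sum (fun σ _ => hasSum_weights s a ha
      (fun j => Real.exp (-tw c s κ D (σ.symm j))) (fun _ => (Real.exp_pos _).le))).mul_left _
  have hhs : Summable h := Summable.of_nonneg_of_le hh0 hhb hbs.summable
  refine ⟨∑' n, h n, tsum_nonneg hh0, ?_, ?_⟩
  · have h1 : ∑' n, h n ≤ _ := hasSum_le hhb hhs.hasSum hbs
    refine h1.trans ?_
    have h2 : ∀ σ ∈ (Finset.univ : Finset (Equiv.Perm (Fin s))),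
        Real.exp (a * ∑ j, Real.exp (-tw c s κ D (σ.symm j))) ≤ Real.exp (a * ((c - 1) - S)) := by
      intro σ _
      rw [Equiv.sum_comp σ.symm (fun i => Real.exp (-tw c s κ D i))]
      gcongr
    have h3 := Finset.sum_le_card_nsmul _ _ _ h2
    rw [nsmul_eq_mul, Finset.card_univ] at h3
    have h4 : E * Real.exp (a * ((c - 1) - S)) = Real.exp (-S * a) := by
      rw [hE, ← Real.exp_add]; ring_nf
    rw [← h4]
    calc _ ≤ C * E * ((Fintype.card (Equiv.Perm (Fin s)) : ℝ) * Real.exp (a * ((c - 1) - S))) := by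
          gcongr
      _ = _ := by ring
  · rw [← (hg.add hhs.hasSum).tsum_eq]
    unfold Bfun
    refine tsum_congr fun n => ?_
    have e : Real.exp (ν * Q ^ (d - c) * (Afun c q s n : ℝ) - a * (c - 1)) =
        Real.exp (-κ * (Afun c q s n : ℝ)) * E := by
      rw [hE, ← Real.exp_add, hκd]; ring_nf
    rw [e]
    simp only [h]
    split_ifs with hP
    · rw [Afun_eq_zero c q s n hP]
      simp [u]
    · simp only [u]; ring

lemma card_fam (c q s : ℕ) (hc2 : 2 ≤ c) (hsc : c ≤ s) (hq : q ≤ c) :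
    ((fam7 c q s).filter fun T => T.card = c - 1).card = Nat.choose (s - q) (s - c + 1) := by
  have hI : (init7 s q)ᶜ.card = s - q := by
    rw [Finset.card_compl, init7, Fin.card_filter_val_lt, Fintype.card_fin]; omega
  rw [← hI, ← Finset.card_powersetCard]
  refine Finset.card_bij (fun T _ => Tᶜ) ?_ ?_ ?_
  · intro T hT
    simp only [fam7, Finset.mem_filter, Finset.mem_univ, true_and] at hT
    rw [Finset.mem_powersetCard, Finset.card_compl, Fintype.card_fin]
    refine ⟨?_, by omega⟩
    rw [Finset.compl_subset_compl]
    have : T = T ∪ init7 s q :=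
      Finset.eq_of_subset_of_card_le Finset.subset_union_left (by omega)
    rw [this]; exact Finset.subset_union_right
  · intro T _ T' _ h
    exact compl_injective h
  · intro U hU
    rw [Finset.mem_powersetCard] at hU
    refine ⟨Uᶜ, ?_, compl_compl U⟩
    have h1 : Uᶜ.card = c - 1 := by
      rw [Finset.card_compl, Fintype.card_fin]; omega
    have h2 : Uᶜ ∪ init7 s q = Uᶜ := by
      rw [Finset.union_eq_left]
      exact Finset.subset_compl_comm.mp hU.1
    simp only [fam7, Finset.mem_filter, Finset.mem_univ, true_and]
    rw [h2]
    omega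

lemma Z_bound (c q s : ℕ) (hc2 : 2 ≤ c) (hsc : c ≤ s) (hq : q ≤ c) (a : ℝ) (ha : 0 < a) :
    |Zfun c q s a - (Nat.choose (s - q) (s - c + 1) : ℝ)| ≤
      ((fam7 c q s).card * c : ℝ) * Real.exp (-a) := by
  rw [← card_fam c q s hc2 hsc hq, Zfun, Finset.sum_mul, ← Finset.sum_boole,
    ← Finset.sum_sub_distrib]
  refine (Finset.abs_sum_le_sum_abs _ _).trans ?_
  rw [mul_assoc, ← nsmul_eq_mul]
  refine Finset.sum_le_card_nsmul _ _ _ ?_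
  intro T hT
  simp only [fam7, Finset.mem_filter, Finset.mem_univ, true_and] at hT
  have hTc : T.card ≤ c - 1 := by
    have := Finset.card_le_card (Finset.subset_union_left (s₁ := T) (s₂ := init7 s q))
    omega
  set z := Real.exp (-a) with hz
  have hz0 : 0 < z := Real.exp_pos _
  have hz1 : z < 1 := by rw [hz, Real.exp_lt_one_iff]; linarith
  obtain ⟨k, hk⟩ := Nat.exists_eq_add_of_le hTc
  have hE : Real.exp (-a * (c - 1)) = z ^ (c - 1) := by
    rw [hz, ← Real.exp_nat_mul, Nat.cast_sub (by omega)]; push_cast; ring_nf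
  have hx : (Real.exp a - 1) ^ T.card * Real.exp (-a * (c - 1)) = (1 - z) ^ T.card * z ^ k := by
    rw [hE, hk, pow_add, ← mul_assoc, ← mul_pow]
    congr 2
    rw [sub_mul, hz, ← Real.exp_add]; simp
  rw [hx]
  have hc1 : (1:ℝ) ≤ c := by
    have : 1 ≤ c := by omega
    exact_mod_cast this
  by_cases hk0 : T.card = c - 1
  · have : k = 0 := by omega
    subst this
    rw [if_pos hk0, hk0, pow_zero, mul_one]
    have h1 : (1 - z) ^ (c - 1) ≤ 1 := pow_le_one₀ (by linarith) (by linarith)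
    have h2 := one_add_mul_le_pow (a := -z) (by linarith) (c - 1)
    rw [Nat.cast_sub (by omega), ← sub_eq_add_neg] at h2
    push_cast at h2
    rw [abs_of_nonpos (by linarith)]
    nlinarith
  · rw [if_neg hk0, sub_zero, abs_of_nonneg (mul_nonneg (pow_nonneg (by linarith) _) (by positivity))]
    have h1 : (1 - z) ^ T.card ≤ 1 := pow_le_one₀ (by linarith) (by linarith)
    have h2 : z ^ k ≤ z := by
      have := pow_le_pow_of_le_one hz0.le hz1.le (show 1 ≤ k by omega)
      simpa using this
    have : (1 - z) ^ T.card * z ^ k ≤ 1 * z := by gcongr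
    nlinarith

lemma Z_ge_one (c s : ℕ) (hc2 : 2 ≤ c) (hsc : c ≤ s) (a : ℝ) (ha : 0 < a) :
    1 ≤ Zfun c 0 s a := by
  obtain ⟨U, -, hU⟩ := Finset.exists_subset_card_eq (s := (Finset.univ : Finset (Fin s)))
    (n := c - 1) (by simp; omega)
  have hx : 0 ≤ Real.exp a - 1 := by have := Real.add_one_le_exp a; linarith
  have h1 : ∑ T ∈ U.powerset, (Real.exp a - 1) ^ T.card ≤
      ∑ T ∈ fam7 c 0 s, (Real.exp a - 1) ^ T.card := by
    refine Finset.sum_le_sum_of_subset_of_nonneg ?_ (fun _ _ _ => by positivity)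
    intro T hT
    have := Finset.card_le_card (Finset.mem_powerset.mp hT)
    simp [fam7, init7]
    omega
  have h2 := Finset.sum_pow_mul_eq_add_pow (Real.exp a - 1) 1 U
  simp only [one_pow, mul_one, sub_add_cancel, hU] at h2
  rw [h2] at h1
  have h3 : Real.exp a ^ (c - 1) * Real.exp (-a * (c - 1)) = 1 := by
    rw [← Real.exp_nat_mul, ← Real.exp_add, Nat.cast_sub (by omega)]
    push_cast
    rw [Real.exp_eq_one_iff]; ring
  rw [Zfun]
  refine h3.symm.le.trans ?_
  exact mul_le_mul_of_nonneg_right h1 (Real.exp_pos _).le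

lemma B_bound (d c q s : ℕ) (hc2 : 2 ≤ c) (hsc : c ≤ s) (hq : q ≤ c) (Q ν : ℝ) (hQ : 0 < Q)
    (hν : ν < 0) :
    ∃ R > (0:ℝ), ∃ S > (0:ℝ), ∀ a > (0:ℝ), Zfun c q s a ≤ Bfun d c ν Q a q s ∧
      |Bfun d c ν Q a q s - (Nat.choose (s - q) (s - c + 1) : ℝ)| ≤ R * Real.exp (-S * a) := by
  obtain ⟨R, hR, S, hS, h⟩ := B_split d c q s hc2 hsc Q ν hQ hν
  refine ⟨R + (fam7 c q s).card * c, by positivity, min S 1, by positivity, ?_⟩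
  intro a ha
  obtain ⟨H, hH0, hH, hB⟩ := h a ha
  refine ⟨by linarith, ?_⟩
  have hZ := Z_bound c q s hc2 hsc hq a ha
  have e1 : Real.exp (-S * a) ≤ Real.exp (-min S 1 * a) := by
    gcongr; exact min_le_left _ _
  have e2 : Real.exp (-a) ≤ Real.exp (-min S 1 * a) := by
    rw [Real.exp_le_exp]; nlinarith [min_le_right S 1]
  have e3 : R * Real.exp (-S * a) ≤ R * Real.exp (-min S 1 * a) := by gcongr
  have e4 : ((fam7 c q s).card * c : ℝ) * Real.exp (-a) ≤
    ((fam7 c q s).card * c : ℝ) * Real.exp (-min S 1 * a) := by gcongr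
  rw [hB, add_sub_right_comm]
  refine (abs_add_le _ _).trans ?_
  rw [abs_of_nonneg hH0, add_mul]
  linarith

/-- Exponential rate for the ratios appearing in the bounds (dbs) on the
correlation functions, from the proof of Lemma 1. -/
theorem stmt7 (d c s p : ℕ) (hc2 : 2 ≤ c) (hcd : c ≤ d) (hsc : c ≤ s) (hpc : p ≤ c)
    (Q₁ Q₂ ν : ℝ) (hQ₁ : 0 < Q₁) (hQ₂ : 0 < Q₂) (hν : ν < 0) :
    ∃ R > (0 : ℝ), ∃ S > (0 : ℝ), ∀ a > (0 : ℝ),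
      0 < Bfun d c ν Q₂ a 0 s ∧
      |Bfun d c ν Q₁ a p s / Bfun d c ν Q₂ a 0 s
          - (Nat.choose (s - p) (s - c + 1) : ℝ) / (Nat.choose s (s - c + 1) : ℝ)|
        < R * Real.exp (-S * a) := by
  obtain ⟨R₁, hR₁, S₁, hS₁, h₁⟩ := B_bound d c p s hc2 hsc hpc Q₁ ν hQ₁ hν
  obtain ⟨R₀, hR₀, S₀, hS₀, h₀⟩ := B_bound d c 0 s hc2 hsc (Nat.zero_le _) Q₂ ν hQ₂ hν
  set N₁ : ℝ := (Nat.choose (s - p) (s - c + 1) : ℝ) with hN₁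
  have hN1 : 0 ≤ N₁ := by positivity
  rw [Nat.sub_zero] at h₀
  have hN0 : (1:ℝ) ≤ (Nat.choose s (s - c + 1) : ℝ) := by
    have : 0 < Nat.choose s (s - c + 1) := Nat.choose_pos (by omega)
    exact_mod_cast this
  set N₀ : ℝ := (Nat.choose s (s - c + 1) : ℝ) with hN₀
  refine ⟨R₁ + N₁ * R₀ + 1, by positivity, min S₁ S₀, by positivity, ?_⟩
  intro a ha
  obtain ⟨-, hb₁⟩ := h₁ a ha
  obtain ⟨hz, hb₀⟩ := h₀ a ha
  have hB : 1 ≤ Bfun d c ν Q₂ a 0 s := (Z_ge_one c s hc2 hsc a ha).trans hz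
  set X := Bfun d c ν Q₁ a p s
  set Y := Bfun d c ν Q₂ a 0 s
  set e := Real.exp (-min S₁ S₀ * a) with he
  have he0 : 0 < e := Real.exp_pos _
  have e1 : Real.exp (-S₁ * a) ≤ e := by
    rw [he]; gcongr; exact min_le_left S₁ S₀
  have e0 : Real.exp (-S₀ * a) ≤ e := by
    rw [he]; gcongr; exact min_le_right _ _
  refine ⟨by linarith, ?_⟩
  have hX : |X - N₁| ≤ R₁ * e := hb₁.trans (by gcongr)
  have hY : |Y - N₀| ≤ R₀ * e := hb₀.trans (by gcongr)
  have hid : X / Y - N₁ / N₀ = (X - N₁) / Y - N₁ * ((Y - N₀) / (Y * N₀)) := by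
    have : Y ≠ 0 := by positivity
    have : N₀ ≠ 0 := by positivity
    field_simp
    ring
  have hYN : 1 ≤ Y * N₀ := one_le_mul_of_one_le_of_one_le hB hN0
  have q1 : |(X - N₁) / Y| ≤ R₁ * e := by
    rw [abs_div, abs_of_pos (by linarith : 0 < Y)]
    exact (div_le_self (abs_nonneg _) hB).trans hX
  have q2 : |N₁ * ((Y - N₀) / (Y * N₀))| ≤ N₁ * (R₀ * e) := by
    rw [abs_mul, abs_of_nonneg hN1, abs_div, abs_of_pos (by linarith : 0 < Y * N₀)]
    gcongr
    exact (div_le_self (abs_nonneg _) hYN).trans hY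
  rw [hid]
  refine (abs_sub _ _).trans_lt ?_
  nlinarith
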